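/- Let (ℛ,≤,r) be a strong topological Ramsey space with its Ellentuck topology. For any 𝒳 ⊆ ℛ, the following are equivalent: (a) 𝒳 is Ramsey; (b) 𝒳 has the abstract Baire property; (c) 𝒳 has the Baire property. -/

import Mathlib

open scoped Topology

namespace AbstractTRS

/-- A combinatorial structure `(ℛ, ≤, r)`: a quasi-ordered set `R` of objects together with
approximation mappings `r : R → ℕ → α` and a finitization relation `≤_fin` on approximations. -/
structure CombStruct (R : Type) (α : Type) where
  le : R → R → Prop
  le_refl : ∀ A, le A A
  le_trans : ∀ {A B C}, le A B → le B C → le A C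
  r : R → ℕ → α
  lefin : α → α → Prop

namespace CombStruct

variable {R α : Type} (S : CombStruct R α)

/-- `𝒜ℛ`, the set of all finite approximations. -/
def AR : Set α := {a | ∃ (A : R) (n : ℕ), S.r A n = a}

/-- `𝒜ℛ_n`, the set of all `n`-approximations. -/
def ARn (n : ℕ) : Set α := {a | ∃ A : R, S.r A n = a}

/-- `a ⊑ b` : `a` is an initial segment of `b`. -/
def Init (a b : α) : Prop := ∃ (C : R) (n m : ℕ), n ≤ m ∧ S.r C n = a ∧ S.r C m = b

/-- `a ⊏ b` : `a` is a proper initial segment of `b`. -/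
def PInit (a b : α) : Prop := S.Init a b ∧ a ≠ b

/-- The basic set `[a, B]`, where `na = |a|` is the length of `a`. -/
def seg (a : α) (na : ℕ) (B : R) : Set R := {X | S.le X B ∧ S.r X na = a}

/-- `[n, B] = [r_n(B), B]`. -/
def segN (n : ℕ) (B : R) : Set R := S.seg (S.r B n) n B

/-- `depth_B(a) < ∞`. -/
def hasDepth (B : R) (a : α) : Prop := ∃ n, S.lefin a (S.r B n)

/-- `depth_B(a)` : the minimal `n` with `a ≤_fin r_n(B)` (junk value `0` if there is none). -/
noncomputable def depth (B : R) (a : α) : ℕ :=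
  letI : DecidablePred fun n => S.lefin a (S.r B n) := Classical.decPred _
  letI : Decidable (∃ n, S.lefin a (S.r B n)) := Classical.dec _
  if h : ∃ n, S.lefin a (S.r B n) then Nat.find h else 0

/-- `r_n''[a,B]`, where `na = |a|`. -/
def rimg (n : ℕ) (a : α) (na : ℕ) (B : R) : Set α :=
  {d | ∃ D ∈ S.seg a na B, S.r D n = d}

/-- Axioms A.1 (metrization). -/
def A1 : Prop :=
  (∀ A B : R, S.r A 0 = S.r B 0) ∧
  (∀ A B : R, A ≠ B → ∃ n, S.r A n ≠ S.r B n) ∧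
  (∀ (A B : R) (n m : ℕ), S.r A n = S.r B m → n = m ∧ ∀ k ≤ n, S.r A k = S.r B k)

/-- Axioms A.2 (finitization): `≤_fin` is a quasi-order on `𝒜ℛ` satisfying A.2.1–A.2.3. -/
def A2 : Prop :=
  (∀ a ∈ S.AR, S.lefin a a) ∧
  (∀ a b c : α, S.lefin a b → S.lefin b c → S.lefin a c) ∧
  (∀ b : α, {a : α | S.lefin a b}.Finite) ∧
  (∀ A B : R, S.le A B ↔ ∀ n : ℕ, ∃ m : ℕ, S.lefin (S.r A n) (S.r B m)) ∧
  (∀ a b c : α, S.Init a b → S.lefin b c → ∃ d : α, S.Init d c ∧ S.lefin a d)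

/-- Axioms A.3 (amalgamation). -/
def A3 : Prop :=
  (∀ (a : α) (na : ℕ), a ∈ S.ARn na → ∀ B : R, S.hasDepth B a →
    ∀ A ∈ S.segN (S.depth B a) B, (S.seg a na A).Nonempty) ∧
  (∀ (a : α) (na : ℕ), a ∈ S.ARn na → ∀ A B : R, S.le A B →
    S.hasDepth B a → S.hasDepth A a → S.depth A a ≤ S.depth B a →
    ∃ A' ∈ S.segN (S.depth B a) B, S.seg a na A' ⊆ S.seg a na A)

/-- Axiom A.4 (abstract pigeonhole principle). -/
def A4 : Prop :=
  ∀ (a : α) (na : ℕ), a ∈ S.ARn na → ∀ B : R, S.hasDepth B a →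
    ∀ O : Set α, O ⊆ S.ARn (na + 1) →
      ∃ A ∈ S.segN (S.depth B a) B,
        S.rimg (na + 1) a na A ⊆ O ∨ O ∩ S.rimg (na + 1) a na A = ∅

/-- `⟨b,B⟩_m^A = {X ∈ [b,B] : depth_A(r_{|b|+1}(X)) > m}`, where `nb = |b|`. -/
def angle (b : α) (nb : ℕ) (B A : R) (m : ℕ) : Set R :=
  {X | X ∈ S.seg b nb B ∧ (S.hasDepth A (S.r X (nb + 1)) → m < S.depth A (S.r X (nb + 1)))}

/-- Axiom A.3*.1 (first axiom of strong amalgamation). -/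
def A3star1 : Prop :=
  ∀ (b : α) (nb : ℕ), b ∈ S.ARn nb → ∀ (A : R) (m : ℕ),
    S.hasDepth A b → S.depth A b ≤ m →
    ∀ B ∈ S.segN m A, (S.angle b nb B A m).Nonempty

/-- Axiom A.3*.2 (second axiom of strong amalgamation). -/
def A3star2 : Prop :=
  ∀ (b : α) (nb : ℕ), b ∈ S.ARn nb → ∀ (A B : R) (m : ℕ), S.le B A →
    S.hasDepth A b → S.depth A b ≤ m → S.hasDepth B b → S.depth B b ≤ S.depth A b →
    ∃ B' ∈ S.segN m A, S.angle b nb B' A m ⊆ S.angle b nb B A m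

/-- Axioms A.3* (strong amalgamation). -/
def A3star : Prop := S.A3star1 ∧ S.A3star2

/-- The structure is metrically closed: `ℛ`, identified with the set of sequences
`(r_n(A))_n`, is closed in `α^ℕ` with `α` discrete. -/
def MetricallyClosed : Prop :=
  @IsClosed (ℕ → α) (@Pi.topologicalSpace ℕ (fun _ => α) (fun _ => ⊥))
    {f | ∃ A : R, ∀ n, f n = S.r A n}

/-- The basic (open) sets `[a,B]` of the Ellentuck topology. -/
def IsBasic (U : Set R) : Prop :=
  ∃ (a : α) (na : ℕ) (B : R), a ∈ S.ARn na ∧ U = S.seg a na B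

/-- The Ellentuck topology on `ℛ`, generated by the basic sets `[a,B]`. -/
def ellentuck : TopologicalSpace R :=
  TopologicalSpace.generateFrom {U | S.IsBasic U}

/-- `(ℛ,≤,r)` is a topological Ramsey space. -/
def IsTRS : Prop := S.MetricallyClosed ∧ S.A1 ∧ S.A2 ∧ S.A3 ∧ S.A4

/-- `(ℛ,≤,r)` is a strong topological Ramsey space. -/
def IsStrongTRS : Prop := S.MetricallyClosed ∧ S.A1 ∧ S.A2 ∧ S.A3star ∧ S.A4

/-- `𝒳 ⊆ ℛ` is Ramsey. -/
def RamseySet (X : Set R) : Prop :=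
  ∀ (a : α) (na : ℕ) (A : R), a ∈ S.ARn na → (S.seg a na A).Nonempty →
    ∃ B ∈ S.seg a na A, S.seg a na B ⊆ X ∨ S.seg a na B ∩ X = ∅

/-- `𝒳 ⊆ ℛ` is Ramsey null. -/
def RamseyNull (X : Set R) : Prop :=
  ∀ (a : α) (na : ℕ) (A : R), a ∈ S.ARn na → (S.seg a na A).Nonempty →
    ∃ B ∈ S.seg a na A, S.seg a na B ∩ X = ∅

/-- `𝒳` is nowhere dense (with respect to the basis of the Ellentuck topology). -/
def NwdB (X : Set R) : Prop :=
  ∀ U : Set R, S.IsBasic U → U.Nonempty →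
    ∃ V : Set R, S.IsBasic V ∧ V.Nonempty ∧ V ⊆ U ∧ V ∩ X = ∅

/-- `𝒳` is meager: a countable union of nowhere dense sets. -/
def MeagerB (X : Set R) : Prop :=
  ∃ f : ℕ → Set R, (∀ i, S.NwdB (f i)) ∧ X = ⋃ i, f i

/-- `𝒳` has the abstract Baire property. -/
def ABP (X : Set R) : Prop :=
  ∀ U : Set R, S.IsBasic U → U.Nonempty →
    ∃ V : Set R, S.IsBasic V ∧ V.Nonempty ∧ V ⊆ U ∧ (V ⊆ X ∨ V ∩ X = ∅)

/-- `𝒳` has the Baire property: `𝒳 △ 𝒪` is meager for some open set `𝒪`. -/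
def BP (X : Set R) : Prop :=
  ∃ O : Set R, IsOpen[S.ellentuck] O ∧ S.MeagerB (symmDiff X O)

/-- `ℛ ↾ H = {A ∈ ℛ : A ≤ H}`. -/
def restrict (H : R) : Set R := {A | S.le A H}

/-- `𝒮_b^𝒬 = {D ∈ ℛ : ∅ ≠ [b,D] ⊆ 𝒬}`, where `nb = |b|`. -/
def Sb (Q : Set R) (b : α) (nb : ℕ) : Set R :=
  {D | (S.seg b nb D).Nonempty ∧ S.seg b nb D ⊆ Q}

/-- `D∞` is a diagonalization of the sequence `{D_n}` inside `[a,B]`: for every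
`b ∈ 𝒜ℛ↾[a,D∞]` (with `|b| = nb`) one has `∅ ≠ [b,D∞] ⊆ [b,D_{n_b}]`,
where `n_b = depth_B(b) - depth_B(a)`. -/
def Diag (a : α) (B : R) (D : ℕ → R) (Dinf : R) : Prop :=
  ∀ (b : α) (nb : ℕ), b ∈ S.ARn nb → S.Init a b → S.hasDepth Dinf b →
    (S.seg b nb Dinf).Nonempty ∧
    S.seg b nb Dinf ⊆ S.seg b nb (D (S.depth B b - S.depth B a))

/-- The space is selective: decreasing sequences inside nonempty basic sets admit
diagonalizations. -/
def Selective : Prop :=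
  ∀ (a : α) (na : ℕ) (B : R), a ∈ S.ARn na → (S.seg a na B).Nonempty →
    ∀ D : ℕ → R, (∀ n, D n ∈ S.seg a na B) → (∀ n, S.le (D (n + 1)) (D n)) →
      ∃ Dinf ∈ S.seg a na B, S.Diag a B D Dinf

/-! ### The abstract Kastanas game `𝒢_{[a₀,B₀]}(𝒳)`

Player I plays objects `A 0, A 1, A 2, …` (the paper's `A₁, A₂, …`) and player II answers
with basic sets `[ak (k+1), Bk (k+1)]` (the paper's `[a₁,B₁], [a₂,B₂], …`), where
`ak 0 = a₀` and `Bk 0 = B₀`; `na = |a₀|`, so `|ak k| = na + k`. -/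

/-- The moves of player I induced by a strategy `σ` (which sees II's previous moves). -/
def playI (σ : List (α × R) → R) (ak : ℕ → α) (Bk : ℕ → R) (k : ℕ) : R :=
  σ (List.ofFn fun i : Fin k => (ak (i.1 + 1), Bk (i.1 + 1)))

/-- Rule for player I's k-th move: `A_{k+1} ∈ [a_k, B_k]`. -/
def ruleI (na : ℕ) (ak : ℕ → α) (Bk : ℕ → R) (A : ℕ → R) (k : ℕ) : Prop :=
  A k ∈ S.seg (ak k) (na + k) (Bk k)

/-- Rule for player II's k-th move: `a_k ⊏ a_{k+1}`, `|a_{k+1}| = |a_k| + 1` and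
`B_{k+1} ∈ [a_{k+1}, A_{k+1}]`. -/
def ruleII (na : ℕ) (ak : ℕ → α) (Bk : ℕ → R) (A : ℕ → R) (k : ℕ) : Prop :=
  (∃ C : R, S.r C (na + k) = ak k ∧ S.r C (na + k + 1) = ak (k + 1)) ∧
  ak k ≠ ak (k + 1) ∧
  Bk (k + 1) ∈ S.seg (ak (k + 1)) (na + k + 1) (A k)

/-- The outcome `B∞`, determined by `{B∞} = ⋂ₖ [a_k]`, belongs to `X`. -/
def limitMem (na : ℕ) (ak : ℕ → α) (X : Set R) : Prop :=
  ∀ Binf : R, ({Binf} : Set R) = ⋂ k : ℕ, {Y : R | S.r Y (na + k) = ak k} → Binf ∈ X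

/-- `σ` is a winning strategy for player I in `𝒢_{[a,B₀]}(𝒳)`: it plays legally at every
legal position consistent with it, and every legal play following it is won by player I. -/
def IWinning (X : Set R) (a : α) (na : ℕ) (B0 : R) (σ : List (α × R) → R) : Prop :=
  (∀ (ak : ℕ → α) (Bk : ℕ → R), ak 0 = a → Bk 0 = B0 → ∀ k : ℕ,
      (∀ i < k, S.ruleII na ak Bk (playI σ ak Bk) i) →
      S.ruleI na ak Bk (playI σ ak Bk) k) ∧
  (∀ (ak : ℕ → α) (Bk : ℕ → R), ak 0 = a → Bk 0 = B0 →
      (∀ k : ℕ, S.ruleI na ak Bk (playI σ ak Bk) k ∧ S.ruleII na ak Bk (playI σ ak Bk) k) →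
      S.limitMem na ak X)

/-- First components of player II's moves induced by a strategy `τ`. -/
def playIIa (a : α) (τ : List R → α × R) (A : ℕ → R) : ℕ → α
  | 0 => a
  | k + 1 => (τ (List.ofFn fun i : Fin (k + 1) => A i.1)).1

/-- Second components of player II's moves induced by a strategy `τ`. -/
def playIIB (B0 : R) (τ : List R → α × R) (A : ℕ → R) : ℕ → R
  | 0 => B0
  | k + 1 => (τ (List.ofFn fun i : Fin (k + 1) => A i.1)).2

/-- `τ` is a winning strategy for player II in `𝒢_{[a,B₀]}(𝒳)`: it plays legally at every
legal position consistent with it, and every legal play following it is won by player II. -/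
def IIWinning (X : Set R) (a : α) (na : ℕ) (B0 : R) (τ : List R → α × R) : Prop :=
  (∀ (A : ℕ → R) (k : ℕ),
      (∀ i ≤ k, S.ruleI na (playIIa a τ A) (playIIB B0 τ A) A i) →
      (∀ i < k, S.ruleII na (playIIa a τ A) (playIIB B0 τ A) A i) →
      S.ruleII na (playIIa a τ A) (playIIB B0 τ A) A k) ∧
  (∀ A : ℕ → R,
      (∀ k : ℕ, S.ruleI na (playIIa a τ A) (playIIB B0 τ A) A k ∧
        S.ruleII na (playIIa a τ A) (playIIB B0 τ A) A k) →
      ∀ Binf : R,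
        ({Binf} : Set R) = ⋂ k : ℕ, {Y : R | S.r Y (na + k) = playIIa a τ A k} →
        Binf ∉ X)

section StrongRamsey

variable {S}

theorem lefin_depth {B : R} {a : α} (h : S.hasDepth B a) : S.lefin a (S.r B (S.depth B a)) := by
  classical
  unfold depth
  rw [dif_pos (show ∃ n, S.lefin a (S.r B n) from h)]
  exact @Nat.find_spec _ (Classical.decPred _) h

theorem depth_le_of_lefin {B : R} {a : α} {n : ℕ} (h : S.lefin a (S.r B n)) :
    S.depth B a ≤ n := by
  classical
  unfold depth
  rw [dif_pos ⟨n, h⟩]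
  exact @Nat.find_min' _ (Classical.decPred _) _ _ h

theorem seg_mono {a : α} {n : ℕ} {A B : R} (h : S.le A B) : S.seg a n A ⊆ S.seg a n B :=
  fun _ hX => ⟨S.le_trans hX.1 h, hX.2⟩

theorem mem_segN_self (n : ℕ) (A : R) : A ∈ S.segN n A := ⟨S.le_refl A, rfl⟩

theorem mem_segN_trans {n : ℕ} {A B C : R} (h : C ∈ S.segN n B) (h' : B ∈ S.segN n A) :
    C ∈ S.segN n A :=
  ⟨S.le_trans h.1 h'.1, h.2.trans h'.2⟩

namespace IsStrongTRS

variable (hS : S.IsStrongTRS)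
include hS

theorem r_eq_of_le {A B : R} {n k : ℕ} (h : S.r A n = S.r B n) (hk : k ≤ n) :
    S.r A k = S.r B k :=
  (hS.2.1.2.2 A B n n h).2 k hk

theorem len_unique {A B : R} {n k : ℕ} (h : S.r A n = S.r B k) : n = k :=
  (hS.2.1.2.2 A B n k h).1

theorem lefin_refl (A : R) (n : ℕ) : S.lefin (S.r A n) (S.r A n) :=
  hS.2.2.1.1 _ ⟨A, n, rfl⟩

theorem hasDepth_self (A : R) (n : ℕ) : S.hasDepth A (S.r A n) := ⟨n, hS.lefin_refl A n⟩

theorem hasDepth_of_le {A B : R} (h : S.le A B) {c : α} (hc : S.hasDepth A c) :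
    S.hasDepth B c := by
  obtain ⟨n, hn⟩ := hc
  obtain ⟨m, hm⟩ := (hS.2.2.1.2.2.2.1 A B).1 h n
  exact ⟨m, hS.2.2.1.2.1 _ _ _ hn hm⟩

theorem hasDepth_r {A B : R} (h : S.le A B) (n : ℕ) : S.hasDepth B (S.r A n) :=
  hS.hasDepth_of_le h (hS.hasDepth_self A n)

theorem hasDepth_of_mem_seg {b : α} {n : ℕ} {B X : R} (h : X ∈ S.seg b n B) :
    S.hasDepth B b :=
  h.2 ▸ hS.hasDepth_r h.1 n

theorem depth_congr {D D' : R} {m : ℕ} (h : S.r D' m = S.r D m) {c : α}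
    (hc : S.hasDepth D c) (hm : S.depth D c ≤ m) :
    S.hasDepth D' c ∧ S.depth D' c = S.depth D c := by
  have h1 : S.lefin c (S.r D' (S.depth D c)) := by
    rw [hS.r_eq_of_le h hm]; exact lefin_depth hc
  have h2 : S.hasDepth D' c := ⟨_, h1⟩
  have h3 := depth_le_of_lefin h1
  refine ⟨h2, le_antisymm h3 ?_⟩
  apply depth_le_of_lefin
  rw [← hS.r_eq_of_le h (h3.trans hm)]
  exact lefin_depth h2

theorem depth_mono_init {C D : R} {n m : ℕ} (hnm : n ≤ m) (h : S.hasDepth D (S.r C m)) :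
    S.hasDepth D (S.r C n) ∧ S.depth D (S.r C n) ≤ S.depth D (S.r C m) := by
  obtain ⟨d, ⟨E, i, j, hij, hi, hj⟩, hd⟩ :=
    hS.2.2.1.2.2.2.2 _ _ _ ⟨C, n, m, hnm, rfl, rfl⟩ (lefin_depth h)
  have hj' := hS.len_unique hj
  subst hj'
  rw [← hi, hS.r_eq_of_le hj hij] at hd
  exact ⟨⟨_, hd⟩, (depth_le_of_lefin hd).trans hij⟩

theorem seg_nonempty {b : α} {n : ℕ} (hb : b ∈ S.ARn n) {D D' : R} (h : S.hasDepth D b)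
    (hD' : D' ∈ S.segN (S.depth D b) D) : (S.seg b n D').Nonempty := by
  obtain ⟨X, hX⟩ := hS.2.2.2.1.1 b n hb D _ h le_rfl D' hD'
  exact ⟨X, hX.1⟩

/-- Depth is strictly increasing along initial segments. -/
theorem depth_lt_succ {C D : R} {n : ℕ} (h : S.hasDepth D (S.r C (n + 1))) :
    S.depth D (S.r C n) < S.depth D (S.r C (n + 1)) := by
  obtain ⟨h0, hle⟩ := hS.depth_mono_init (Nat.le_succ n) h
  refine lt_of_le_of_ne hle fun heq => ?_
  obtain ⟨A, hA, hA'⟩ := hS.2.2.2.2 _ n ⟨C, rfl⟩ D h0 {S.r C (n + 1)}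
    (by rintro _ rfl; exact ⟨C, rfl⟩)
  obtain ⟨X, hX⟩ := hS.seg_nonempty ⟨C, rfl⟩ h (heq ▸ hA)
  have hXn : S.r X n = S.r C n := hS.r_eq_of_le hX.2 (Nat.le_succ n)
  rcases hA' with hA' | hA'
  · obtain ⟨Y, hY, hY'⟩ := hS.2.2.2.1.1 _ n ⟨C, rfl⟩ D _ h0 le_rfl A hA
    have hYe : S.r Y (n + 1) = S.r C (n + 1) := hA' ⟨Y, hY, rfl⟩
    rw [hYe] at hY'
    exact absurd (hY' h) (by rw [heq]; exact lt_irrefl _)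
  · have : S.r C (n + 1) ∈ ({S.r C (n + 1)} : Set α) ∩ S.rimg (n + 1) (S.r C n) n A :=
      ⟨rfl, X, ⟨hX.1, hXn⟩, hX.2⟩
    rw [hA'] at this
    exact this

theorem le_depth {b : α} {n : ℕ} (hb : b ∈ S.ARn n) {D : R} (h : S.hasDepth D b) :
    n ≤ S.depth D b := by
  obtain ⟨C, rfl⟩ := hb
  induction n with
  | zero => exact Nat.zero_le _
  | succ n ih =>
    have h1 := ih (hS.depth_mono_init (Nat.le_succ n) h).1
    have h2 := hS.depth_lt_succ h
    omega

theorem depth_self (A : R) (n : ℕ) : S.depth A (S.r A n) = n :=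
  le_antisymm (depth_le_of_lefin (hS.lefin_refl A n))
    (hS.le_depth ⟨A, rfl⟩ (hS.hasDepth_self A n))

/-- The second axiom of (ordinary) amalgamation. -/
theorem exists_seg_subset {b : α} {n : ℕ} (hb : b ∈ S.ARn n) {A B : R} (hBA : S.le B A)
    (hB : S.hasDepth B b) (hle : S.depth B b ≤ S.depth A b) :
    ∃ B' ∈ S.segN (S.depth A b) A, S.seg b n B' ⊆ S.seg b n B := by
  obtain ⟨B', hB', hsub⟩ :=
    hS.2.2.2.1.2 b n hb A B _ hBA (hS.hasDepth_of_le hBA hB) le_rfl hB hle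
  refine ⟨B', hB', fun X hX => (hsub ⟨hX, fun h => ?_⟩).1⟩
  have := hS.depth_lt_succ h
  rwa [hX.2] at this

theorem exists_limit {f : ℕ → α} (h : ∀ n, ∃ A : R, ∀ k ≤ n, f k = S.r A k) :
    ∃ D : R, ∀ n, f n = S.r D n := by
  let _ : TopologicalSpace α := ⊥
  have : DiscreteTopology α := ⟨rfl⟩
  have hc : IsClosed {f : ℕ → α | ∃ A : R, ∀ n, f n = S.r A n} := hS.1
  choose A hA using h
  have hmem : f ∈ {f : ℕ → α | ∃ A : R, ∀ n, f n = S.r A n} := by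
    refine hc.mem_of_tendsto (f := fun n k => S.r (A n) k) (b := Filter.atTop) ?_
      (Filter.Eventually.of_forall fun n => ⟨A n, fun _ => rfl⟩)
    rw [tendsto_pi_nhds]
    intro k
    refine tendsto_const_nhds.congr' ?_
    filter_upwards [Filter.eventually_ge_atTop k] with n hn
    exact hA n k hn
  exact hmem

theorem exists_step {P : α → ℕ → R → Prop} {A : R}
    (hex : ∀ b n D, S.le D A → b ∈ S.ARn n → S.hasDepth D b →
      ∃ D' ∈ S.segN (S.depth D b) D, P b n D')
    (hher : ∀ b n D D', S.hasDepth D b → D' ∈ S.segN (S.depth D b) D → P b n D → P b n D')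
    {D : R} (hDA : S.le D A) (m : ℕ) :
    ∃ D' ∈ S.segN m D, ∀ b n, b ∈ S.ARn n → S.hasDepth D' b → S.depth D' b = m → P b n D' := by
  have key : ∀ s : Finset α, ∃ D' ∈ S.segN m D, ∀ b ∈ s, ∀ n, b ∈ S.ARn n →
      S.hasDepth D' b → S.depth D' b = m → P b n D' := by
    classical
    intro s
    induction s using Finset.induction_on with
    | empty => exact ⟨D, mem_segN_self m D, by simp⟩
    | insert c s _ ih =>
      obtain ⟨D', hD', hP⟩ := ih
      have hold : ∀ D'' ∈ S.segN m D', ∀ b ∈ s, ∀ n, b ∈ S.ARn n →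
          S.hasDepth D'' b → S.depth D'' b = m → P b n D'' := by
        intro D'' hD'' b hbs n hb h1 h2
        obtain ⟨h3, h4⟩ := hS.depth_congr hD''.2.symm h1 h2.le
        rw [h2] at h4
        exact hher b n D' D'' h3 (h4.symm ▸ hD'') (hP b hbs n hb h3 h4)
      by_cases hc : ∃ n, c ∈ S.ARn n ∧ S.hasDepth D' c ∧ S.depth D' c = m
      · obtain ⟨n, hcn, hc1, hc2⟩ := hc
        obtain ⟨D'', hD'', hPc⟩ := hex c n D' (S.le_trans hD'.1 hDA) hcn hc1
        rw [hc2] at hD''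
        refine ⟨D'', mem_segN_trans hD'' hD', fun b hb k hbk h1 h2 => ?_⟩
        rcases Finset.mem_insert.1 hb with rfl | hb
        · obtain ⟨X, hX⟩ := hbk
          obtain ⟨Y, hY⟩ := hcn
          rw [hS.len_unique (hX.trans hY.symm)]
          exact hPc
        · exact hold D'' hD'' b hb k hbk h1 h2
      · refine ⟨D', hD', fun b hb k hbk h1 h2 => ?_⟩
        rcases Finset.mem_insert.1 hb with rfl | hb
        · exact absurd ⟨k, hbk, h1, h2⟩ hc
        · exact hP b hb k hbk h1 h2
  obtain ⟨D', hD', hP⟩ := key (hS.2.2.1.2.2.1 (S.r D m)).toFinset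
  refine ⟨D', hD', fun b n hb h1 h2 => hP b ?_ n hb h1 h2⟩
  have := lefin_depth h1
  rw [h2, hD'.2] at this
  simpa using this

/-- Fusion: a property of pairs `(b, D)` that can be achieved in `[depth_D(b), D]` and is
inherited there can be achieved for all `b` simultaneously. -/
theorem fusion {P : α → ℕ → R → Prop} (A : R) (m₀ : ℕ)
    (hex : ∀ b n D, S.le D A → b ∈ S.ARn n → S.hasDepth D b →
      ∃ D' ∈ S.segN (S.depth D b) D, P b n D')
    (hher : ∀ b n D D', S.hasDepth D b → D' ∈ S.segN (S.depth D b) D → P b n D → P b n D') :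
    ∃ D ∈ S.segN m₀ A, ∀ b n, b ∈ S.ARn n → S.hasDepth D b → m₀ ≤ S.depth D b → P b n D := by
  have step : ∀ (m : ℕ) (D : {D // S.le D A}), ∃ D' : {D // S.le D A},
      D'.1 ∈ S.segN (m₀ + m) D.1 ∧ ∀ b n, b ∈ S.ARn n →
        S.hasDepth D'.1 b → S.depth D'.1 b = m₀ + m → P b n D'.1 := fun m D => by
    obtain ⟨D', hD', h⟩ := hS.exists_step hex hher D.2 (m₀ + m)
    exact ⟨⟨D', S.le_trans hD'.1 D.2⟩, hD', h⟩
  choose F hF hFP using step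
  let D₀ : ℕ → {D // S.le D A} := fun m => Nat.rec ⟨A, S.le_refl A⟩ F m
  let D : ℕ → R := fun m => (D₀ m).1
  have hD : ∀ m, D (m + 1) ∈ S.segN (m₀ + m) (D m) := fun m => hF m (D₀ m)
  have hDP : ∀ m b n, b ∈ S.ARn n → S.hasDepth (D (m + 1)) b →
      S.depth (D (m + 1)) b = m₀ + m → P b n (D (m + 1)) := fun m => hFP m (D₀ m)
  have hmono : ∀ m k, D (m + k) ∈ S.segN (m₀ + m) (D m) := by
    intro m k
    induction k with
    | zero => exact mem_segN_self _ _
    | succ k ih =>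
      have h := hD (m + k)
      exact ⟨S.le_trans h.1 ih.1, (hS.r_eq_of_le h.2 (by omega)).trans ih.2⟩
  have hmono' : ∀ {m k}, m ≤ k → D k ∈ S.segN (m₀ + m) (D m) := by
    intro m k h
    obtain ⟨j, rfl⟩ := Nat.exists_eq_add_of_le h
    exact hmono m j
  obtain ⟨E, hE⟩ := hS.exists_limit (f := fun n => S.r (D n) n) fun n =>
    ⟨D n, fun k hk => (hS.r_eq_of_le (hmono' hk).2 (by omega)).symm⟩
  have hEr : ∀ m, S.r E (m₀ + m) = S.r (D m) (m₀ + m) := fun m => by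
    rw [← hE]; exact (hmono' (by omega)).2
  have hEle : ∀ m, S.le E (D m) := by
    intro m
    rw [hS.2.2.1.2.2.2.1]
    intro n
    have h1 : S.r E n = S.r (D (m + n)) n :=
      hS.r_eq_of_le (hEr (m + n)) (by omega)
    rw [h1]
    exact (hS.2.2.1.2.2.2.1 _ _).1 (hmono m n).1 n
  refine ⟨E, ⟨hEle 0, hEr 0⟩, fun b n hb h1 h2 => ?_⟩
  obtain ⟨m, hm⟩ := Nat.exists_eq_add_of_le h2
  have hr : S.r E (m₀ + m) = S.r (D (m + 1)) (m₀ + m) := (hEr m).trans (hD m).2.symm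
  obtain ⟨h3, h4⟩ := hS.depth_congr hr.symm h1 hm.le
  rw [hm] at h4
  exact hher b n _ E h3 (h4.symm ▸ (⟨hEle (m + 1), hr⟩ : E ∈ S.segN (m₀ + m) (D (m + 1))))
    (hDP m b n hb h3 h4)

/-- Below any `E`, an approximation can be prevented from appearing at its own depth. -/
theorem exists_not_hasDepth {c : α} {l n : ℕ} (hc : c ∈ S.ARn l) {E : R}
    (h : S.hasDepth E c) (hd : S.depth E c = n + 1) :
    ∃ E' ∈ S.segN n E, ¬ S.hasDepth E' c := by
  obtain ⟨C, rfl⟩ := hc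
  cases l with
  | zero =>
    rw [hS.2.1.1 C E, hS.depth_self] at hd
    omega
  | succ l =>
    have h0 := (hS.depth_mono_init (Nat.le_succ l) h).1
    have hlt := hS.depth_lt_succ h
    obtain ⟨B, hB, hB'⟩ := hS.2.2.2.2 _ l ⟨C, rfl⟩ E h0 {S.r C (l + 1)}
      (by rintro _ rfl; exact ⟨C, rfl⟩)
    obtain ⟨hB0, hBd⟩ := hS.depth_congr hB.2 h0 le_rfl
    have hnot : S.r C (l + 1) ∉ S.rimg (l + 1) (S.r C l) l B := by
      rcases hB' with hB' | hB'
      · rintro ⟨Z, hZ, hZe⟩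
        have hBc : S.hasDepth B (S.r C (l + 1)) := hZe ▸ hS.hasDepth_r hZ.1 _
        obtain ⟨X, hX, hX'⟩ := hS.2.2.2.1.1 _ l ⟨C, rfl⟩ B (S.depth B (S.r C (l + 1))) hB0
          (hS.depth_lt_succ hBc).le B (mem_segN_self _ _)
        have hXe : S.r X (l + 1) = S.r C (l + 1) := hB' ⟨X, hX, rfl⟩
        rw [hXe] at hX'
        exact lt_irrefl _ (hX' hBc)
      · intro hmem
        have : S.r C (l + 1) ∈ ({S.r C (l + 1)} : Set α) ∩ S.rimg (l + 1) (S.r C l) l B :=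
          ⟨rfl, hmem⟩
        rw [hB'] at this
        exact this
    obtain ⟨E', hE', hsub⟩ := hS.2.2.2.1.2 _ l ⟨C, rfl⟩ E B n hB.1 h0 (by omega) hB0 hBd.le
    refine ⟨E', hE', fun hE'c => hnot ?_⟩
    obtain ⟨X, hX⟩ := hS.seg_nonempty ⟨C, rfl⟩ hE'c (mem_segN_self _ _)
    have hX' : X ∈ S.angle (S.r C l) l E' E n := by
      refine ⟨⟨hX.1, hS.r_eq_of_le hX.2 (Nat.le_succ l)⟩, fun _ => ?_⟩
      rw [hX.2, hd]
      exact Nat.lt_succ_self n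
    exact ⟨X, (hsub hX').1, hX.2⟩

/-- `c` is not caught by a one-step extension of `b` in `D` unless it is already caught by an
initial segment of `b`. -/
theorem exists_no_delay {b : α} {n : ℕ} (hb : b ∈ S.ARn n) {D : R} (h : S.hasDepth D b)
    {c : α} (hc : c ∈ S.AR) :
    ∃ D' ∈ S.segN (S.depth D b) D, ∀ X ∈ S.seg b n D', S.lefin c (S.r X (n + 1)) →
      ∃ j ≤ n, S.lefin c (S.r X j) := by
  obtain ⟨F, hF, hF'⟩ := hS.2.2.2.2 b n hb D h {e | e ∈ S.ARn (n + 1) ∧ S.lefin c e}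
    fun _ he => he.1
  refine ⟨F, hF, fun X hX hcX => ?_⟩
  rcases hF' with hF' | hF'
  · by_contra! hno
    have hXc : S.hasDepth X c := ⟨_, hcX⟩
    have hXd : S.depth X c = n + 1 := by
      refine le_antisymm (depth_le_of_lefin hcX) ?_
      by_contra! hlt
      exact hno _ (Nat.lt_succ_iff.1 hlt) (lefin_depth hXc)
    obtain ⟨C, l, hC⟩ := hc
    obtain ⟨Y, hY, hYc⟩ := hS.exists_not_hasDepth ⟨C, hC⟩ hXc hXd
    have hmem : Y ∈ S.seg b n F := ⟨S.le_trans hY.1 hX.1, hY.2.trans hX.2⟩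
    exact hYc ⟨_, (hF' ⟨Y, hmem, rfl⟩).2⟩
  · have hmem : S.r X (n + 1) ∈ {e | e ∈ S.ARn (n + 1) ∧ S.lefin c e} ∩
        S.rimg (n + 1) b n F := ⟨⟨⟨X, rfl⟩, hcX⟩, X, hX, rfl⟩
    rw [hF'] at hmem
    exact hmem.elim

theorem exists_no_delay_all {b : α} {n : ℕ} (hb : b ∈ S.ARn n) {D : R} (h : S.hasDepth D b) :
    ∃ D' ∈ S.segN (S.depth D b) D, ∀ c ∈ S.AR, S.hasDepth D' c →
      S.depth D' c ≤ S.depth D' b → ∀ X ∈ S.seg b n D', S.lefin c (S.r X (n + 1)) →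
        ∃ j ≤ n, S.lefin c (S.r X j) := by
  have key : ∀ s : Finset α, ∃ D' ∈ S.segN (S.depth D b) D, ∀ c ∈ s, c ∈ S.AR →
      ∀ X ∈ S.seg b n D', S.lefin c (S.r X (n + 1)) → ∃ j ≤ n, S.lefin c (S.r X j) := by
    classical
    intro s
    induction s using Finset.induction_on with
    | empty => exact ⟨D, mem_segN_self _ D, by simp⟩
    | insert c s _ ih =>
      obtain ⟨D', hD', hP⟩ := ih
      by_cases hc : c ∈ S.AR
      · obtain ⟨h1, h2⟩ := hS.depth_congr hD'.2 h le_rfl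
        obtain ⟨D'', hD'', hPc⟩ := hS.exists_no_delay hb h1 hc
        rw [h2] at hD''
        refine ⟨D'', mem_segN_trans hD'' hD', fun e he heA X hX => ?_⟩
        rcases Finset.mem_insert.1 he with rfl | he
        · exact hPc X hX
        · exact hP e he heA X (seg_mono hD''.1 hX)
      · refine ⟨D', hD', fun e he heA => ?_⟩
        rcases Finset.mem_insert.1 he with rfl | he
        · exact absurd heA hc
        · exact hP e he heA
  have hfin : (⋃ j ∈ Finset.range (S.depth D b + 1), {c | S.lefin c (S.r D j)}).Finite :=
    Set.Finite.biUnion (Finset.finite_toSet _) fun j _ => hS.2.2.1.2.2.1 _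
  obtain ⟨D', hD', hP⟩ := key hfin.toFinset
  refine ⟨D', hD', fun c hcA hc hle => hP c ?_ hcA⟩
  rw [(hS.depth_congr hD'.2 h le_rfl).2] at hle
  have h1 := lefin_depth hc
  rw [hS.r_eq_of_le hD'.2 hle] at h1
  simp only [Set.Finite.mem_toFinset, Set.mem_iUnion, Finset.mem_range, Set.mem_ofPred_eq]
  exact ⟨_, Nat.lt_succ_of_le hle, h1⟩

/-- Every `A` has some `D ∈ [n, A]` below which depths of long approximations do not increase and
which decides, for every long approximation `b`, whether `[b, E] ⊆ O` for some `E ≤ D`. -/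
theorem exists_deciding (O : Set R) (A : R) (na : ℕ) :
    ∃ D ∈ S.segN na A, ∀ b n, b ∈ S.ARn n → na ≤ n → S.hasDepth D b →
      S.seg b n D ⊆ O ∨ ∀ E, S.le E D → (S.seg b n E).Nonempty → ¬ S.seg b n E ⊆ O := by
  obtain ⟨D, hD, hP⟩ := hS.fusion A na
    (P := fun b n D => (S.seg b n D ⊆ O ∨ ∀ E ∈ S.segN (S.depth D b) D, ¬ S.seg b n E ⊆ O) ∧
      ∀ c ∈ S.AR, S.hasDepth D c → S.depth D c ≤ S.depth D b → ∀ X ∈ S.seg b n D,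
        S.lefin c (S.r X (n + 1)) → ∃ j ≤ n, S.lefin c (S.r X j))
    (by
      intro b n D _ hb h
      obtain ⟨D', hD', hnd⟩ := hS.exists_no_delay_all hb h
      obtain ⟨h1, h2⟩ := hS.depth_congr hD'.2 h le_rfl
      by_cases hO : ∃ E ∈ S.segN (S.depth D' b) D', S.seg b n E ⊆ O
      · obtain ⟨E, hE, hEO⟩ := hO
        refine ⟨E, mem_segN_trans (h2 ▸ hE) hD', Or.inl hEO, fun c hcA hc hle X hX => ?_⟩
        rw [(hS.depth_congr hE.2 h1 le_rfl).2] at hle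
        obtain ⟨h3, h4⟩ := hS.depth_congr hE.2.symm hc hle
        exact hnd c hcA h3 (h4.trans_le hle) X (seg_mono hE.1 hX)
      · push Not at hO
        exact ⟨D', hD', Or.inr hO, hnd⟩)
    (by
      intro b n D E h1 hE ⟨hdec, hnd⟩
      obtain ⟨-, h2⟩ := hS.depth_congr hE.2 h1 le_rfl
      refine ⟨hdec.imp (seg_mono hE.1).trans ?_, fun c hcA hc hle X hX => ?_⟩
      · intro hrej F hF
        rw [h2] at hF
        exact hrej F (mem_segN_trans hF hE)
      · rw [h2] at hle
        obtain ⟨h3, h4⟩ := hS.depth_congr hE.2.symm hc hle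
        exact hnd c hcA h3 (h4.trans_le hle) X (seg_mono hE.1 hX))
  refine ⟨D, hD, fun b n hb hn h => ?_⟩
  have hnd := hS.le_depth hb h
  refine (hP b n hb h (hn.trans hnd)).1.imp_right fun hrej E hED hne hEO => ?_
  obtain ⟨Y, hY⟩ := hne
  have hEb := hS.hasDepth_of_mem_seg hY
  have hle : S.depth E b ≤ S.depth D b := by
    cases hk : S.depth E b with
    | zero => exact Nat.zero_le _
    | succ k =>
      have hek := hS.hasDepth_r hED k
      have hkd := hS.le_depth ⟨E, rfl⟩ hek
      by_contra! hlt
      have hbe : S.depth D b ≤ S.depth D (S.r E k) := by omega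
      obtain ⟨j, hj, hbj⟩ := (hP _ k ⟨E, rfl⟩ hek (by omega)).2 b ⟨Y, n, hY.2⟩ h hbe E
        ⟨hED, rfl⟩ (hk ▸ lefin_depth hEb)
      have := depth_le_of_lefin hbj
      omega
  obtain ⟨B, hB, hBE⟩ := hS.exists_seg_subset hb hED hEb hle
  exact hrej B hB (hBE.trans hEO)

/-- The Galvin–Prikry type dichotomy underlying the abstract Ellentuck theorem. -/
theorem dichotomy (O : Set R) (A : R) (na : ℕ) :
    ∃ B ∈ S.segN na A, S.segN na B ⊆ O ∨
      ∀ X ∈ S.segN na B, ∀ n, na ≤ n → ¬ S.segN n X ⊆ O := by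
  obtain ⟨D, hD, hdec⟩ := hS.exists_deciding O A na
  let Rej : α → ℕ → Prop :=
    fun b n => ∀ E, S.le E D → (S.seg b n E).Nonempty → ¬ S.seg b n E ⊆ O
  rcases hdec (S.r D na) na ⟨D, rfl⟩ le_rfl (hS.hasDepth_self D na) with hacc | hrej
  · exact ⟨D, hD, Or.inl hacc⟩
  obtain ⟨B, hB, hP⟩ := hS.fusion D na
    (P := fun b n F => na ≤ n → Rej b n →
      ∀ X ∈ S.seg b n F, Rej (S.r X (n + 1)) (n + 1))
    (by
      intro b n F hFD hb h
      by_cases hcond : na ≤ n ∧ Rej b n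
      · obtain ⟨hn, hbr⟩ := hcond
        obtain ⟨G, hG, hG'⟩ := hS.2.2.2.2 b n hb F h {e | e ∈ S.ARn (n + 1) ∧ Rej e (n + 1)}
          fun _ he => he.1
        have hGD := S.le_trans hG.1 hFD
        refine ⟨G, hG, fun _ _ X hX => ?_⟩
        rcases hG' with hG' | hG'
        · exact (hG' ⟨X, hX, rfl⟩).2
        · refine absurd ?_ (hbr G hGD ⟨X, hX⟩)
          intro Y hY
          have hYD := S.le_trans hY.1 hGD
          rcases hdec (S.r Y (n + 1)) (n + 1) ⟨Y, rfl⟩ (by omega) (hS.hasDepth_r hYD _) with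
            hacc | hr
          · exact hacc ⟨hYD, rfl⟩
          · have hmem : S.r Y (n + 1) ∈ {e | e ∈ S.ARn (n + 1) ∧ Rej e (n + 1)} ∩
                S.rimg (n + 1) b n G := ⟨⟨⟨Y, rfl⟩, hr⟩, Y, hY, rfl⟩
            rw [hG'] at hmem
            exact hmem.elim
      · exact ⟨F, mem_segN_self _ F, fun h1 h2 => absurd ⟨h1, h2⟩ hcond⟩)
    (by
      intro b n F G _ hG hPF hn hbr X hX
      exact hPF hn hbr X (seg_mono hG.1 hX))
  refine ⟨B, mem_segN_trans hB hD, Or.inr fun X hX n hn => ?_⟩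
  have hXD := S.le_trans hX.1 hB.1
  have hR : Rej (S.r X n) n := by
    induction n, hn using Nat.le_induction with
    | base => rw [hX.2, hB.2]; exact hrej
    | succ k hk ih =>
      have hXk := hS.hasDepth_r hX.1 k
      exact hP _ k ⟨X, rfl⟩ hXk (hk.trans (hS.le_depth ⟨X, rfl⟩ hXk)) hk ih X ⟨hX.1, rfl⟩
  exact hR X hXD ⟨X, S.le_refl X, rfl⟩

theorem exists_segN_subset_of_isOpen {O : Set R} (hO : IsOpen[S.ellentuck] O)
    {X : R} (hX : X ∈ O) : ∃ n₀, ∀ n, n₀ ≤ n → S.segN n X ⊆ O := by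
  induction hO with
  | basic U hU =>
    obtain ⟨b, m, E, -, rfl⟩ := hU
    refine ⟨m, fun n hn Y hY => ⟨S.le_trans hY.1 hX.1, ?_⟩⟩
    rw [hS.r_eq_of_le hY.2 hn]
    exact hX.2
  | univ => exact ⟨0, fun _ _ => Set.subset_univ _⟩
  | inter U V _ _ ihU ihV =>
    obtain ⟨i, hi⟩ := ihU hX.1
    obtain ⟨j, hj⟩ := ihV hX.2
    exact ⟨max i j, fun n hn => Set.subset_inter (hi n (by omega)) (hj n (by omega))⟩
  | sUnion T _ ih =>
    obtain ⟨U, hU, hXU⟩ := hX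
    obtain ⟨i, hi⟩ := ih U hU hXU
    exact ⟨i, fun n hn => (hi n hn).trans (Set.subset_sUnion_of_mem hU)⟩

theorem ramseySet_of_isOpen {O : Set R} (hO : IsOpen[S.ellentuck] O) : S.RamseySet O := by
  rintro a na A - ⟨A', hA'⟩
  obtain ⟨B, hB, h⟩ := hS.dichotomy O A' na
  have hBa : S.r B na = a := hB.2.trans hA'.2
  refine ⟨B, ⟨S.le_trans hB.1 hA'.1, hBa⟩, ?_⟩
  rw [← hBa]
  refine h.imp_right fun h => Set.eq_empty_of_forall_notMem fun X ⟨hX, hXO⟩ => ?_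
  obtain ⟨n₀, hn₀⟩ := hS.exists_segN_subset_of_isOpen hO hXO
  exact h X hX (max n₀ na) (le_max_right _ _) (hn₀ _ (le_max_left _ _))

theorem ramseyNull_of_nwdB {N : Set R} (hN : S.NwdB N) : S.RamseyNull N := by
  rintro a na A - ⟨A', hA'⟩
  obtain ⟨B, hB, h⟩ := hS.dichotomy Nᶜ A' na
  have hBa : S.r B na = a := hB.2.trans hA'.2
  refine ⟨B, ⟨S.le_trans hB.1 hA'.1, hBa⟩, ?_⟩
  rw [← hBa]
  rcases h with h | h
  · exact (Set.subset_compl_iff_disjoint_right.1 h).inter_eq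
  · obtain ⟨V, ⟨b, m, E, -, rfl⟩, ⟨X, hX⟩, hVU, hVN⟩ :=
      hN (S.segN na B) ⟨_, na, B, ⟨B, rfl⟩, rfl⟩ ⟨B, mem_segN_self na B⟩
    refine absurd (fun Y hY hYN => ?_) (h X (hVU hX) (max m na) (le_max_right _ _))
    have hYV : Y ∈ S.seg b m E ∩ N :=
      ⟨⟨S.le_trans hY.1 hX.1, (hS.r_eq_of_le hY.2 (le_max_left _ _)).trans hX.2⟩, hYN⟩
    rw [hVN] at hYV
    exact hYV

theorem ramseyNull_of_meagerB {M : Set R} (hM : S.MeagerB M) : S.RamseyNull M := by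
  obtain ⟨N, hN, rfl⟩ := hM
  have hfin : ∀ (b : α) (n k : ℕ) (D : R), b ∈ S.ARn n → (S.seg b n D).Nonempty →
      ∃ E ∈ S.seg b n D, ∀ i < k, S.seg b n E ∩ N i = ∅ := by
    intro b n k D hb hne
    induction k with
    | zero => exact ⟨hne.some, hne.some_mem, fun i hi => absurd hi (Nat.not_lt_zero i)⟩
    | succ k ih =>
      obtain ⟨E, hE, hEN⟩ := ih
      obtain ⟨F, hF, hFN⟩ := hS.ramseyNull_of_nwdB (hN k) b n E hb ⟨E, S.le_refl E, hE.2⟩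
      refine ⟨F, seg_mono hE.1 hF, fun i hi => ?_⟩
      rcases Nat.lt_succ_iff_lt_or_eq.1 hi with hi | rfl
      · exact Set.subset_empty_iff.1
          ((Set.inter_subset_inter_left _ (seg_mono hF.1)).trans (hEN i hi).subset)
      · exact hFN
  rintro a na A - ⟨A', hA'⟩
  obtain ⟨B, hB, hP⟩ := hS.fusion A' na
    (P := fun b n D => ∀ i ≤ n, S.seg b n D ∩ N i = ∅)
    (by
      intro b n D _ hb h
      obtain ⟨E, hE, hEN⟩ := hfin b n (n + 1) D hb (hS.seg_nonempty hb h (mem_segN_self _ _))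
      have hEb : S.hasDepth E b := hE.2 ▸ hS.hasDepth_self E n
      have hle : S.depth E b ≤ S.depth D b := by
        conv_lhs => rw [← hE.2, hS.depth_self]
        exact hS.le_depth hb h
      obtain ⟨D', hD', hsub⟩ := hS.exists_seg_subset hb hE.1 hEb hle
      exact ⟨D', hD', fun i hi => Set.subset_empty_iff.1
        ((Set.inter_subset_inter_left _ hsub).trans (hEN i (Nat.lt_succ_of_le hi)).subset)⟩)
    (fun b n D D' _ hD' h i hi => Set.subset_empty_iff.1
      ((Set.inter_subset_inter_left _ (seg_mono hD'.1)).trans (h i hi).subset))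
  refine ⟨B, ⟨S.le_trans hB.1 hA'.1, hB.2.trans hA'.2⟩,
    Set.eq_empty_of_forall_notMem fun X ⟨hX, hXN⟩ => ?_⟩
  obtain ⟨i, hi⟩ := Set.mem_iUnion.1 hXN
  have hXd := hS.hasDepth_r hX.1 (max i na)
  have hmem : X ∈ S.seg (S.r X (max i na)) (max i na) B ∩ N i := ⟨⟨hX.1, rfl⟩, hi⟩
  rw [hP _ (max i na) ⟨X, rfl⟩ hXd
    ((le_max_right _ _).trans (hS.le_depth ⟨X, rfl⟩ hXd)) i (le_max_left _ _)] at hmem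
  exact hmem

theorem ramseySet_of_bp {X : Set R} (hX : S.BP X) : S.RamseySet X := by
  obtain ⟨O, hO, hM⟩ := hX
  intro a na A ha hne
  obtain ⟨B, hB, hBM⟩ := hS.ramseyNull_of_meagerB hM a na A ha hne
  obtain ⟨C, hC, hCO⟩ := hS.ramseySet_of_isOpen hO a na B ha ⟨B, S.le_refl B, hB.2⟩
  have hiff : ∀ Y ∈ S.seg a na C, (Y ∈ X ↔ Y ∈ O) := by
    intro Y hY
    have hYM : Y ∉ symmDiff X O := fun h =>
      (Set.eq_empty_iff_forall_notMem.1 hBM) Y ⟨seg_mono hC.1 hY, h⟩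
    rw [Set.mem_symmDiff] at hYM
    tauto
  refine ⟨C, seg_mono hB.1 hC, hCO.imp (fun h Y hY => (hiff Y hY).2 (h hY)) fun h => ?_⟩
  exact Set.eq_empty_of_forall_notMem fun Y hY =>
    (Set.eq_empty_iff_forall_notMem.1 h) Y ⟨hY.1, (hiff Y hY.1).1 hY.2⟩

end IsStrongTRS

theorem RamseySet.abp {X : Set R} (hX : S.RamseySet X) : S.ABP X := by
  rintro U ⟨a, na, A, ha, rfl⟩ hne
  obtain ⟨B, hB, h⟩ := hX a na A ha hne
  exact ⟨S.seg a na B, ⟨a, na, B, ha, rfl⟩, ⟨B, S.le_refl B, hB.2⟩, seg_mono hB.1, h⟩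

theorem ABP.bp {X : Set R} (hX : S.ABP X) : S.BP X := by
  let O : Set R := ⋃₀ {V | S.IsBasic V ∧ V ⊆ X}
  have hOX : O ⊆ X := Set.sUnion_subset fun V hV => hV.2
  have hnwd : S.NwdB (symmDiff X O) := by
    intro U hU hne
    obtain ⟨V, hV, hVne, hVU, h⟩ := hX U hU hne
    refine ⟨V, hV, hVne, hVU, Set.eq_empty_of_forall_notMem fun Y ⟨hY, hYd⟩ => ?_⟩
    rcases h with h | h
    · have hYO : Y ∈ O := ⟨V, ⟨hV, h⟩, hY⟩
      rcases hYd with hYd | hYd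
      · exact hYd.2 hYO
      · exact hYd.2 (h hY)
    · have hYX : Y ∉ X := fun hYX => (Set.eq_empty_iff_forall_notMem.1 h) Y ⟨hY, hYX⟩
      rcases hYd with hYd | hYd
      · exact hYX hYd.1
      · exact hYX (hOX hYd.1)
  exact ⟨O, .sUnion _ fun V hV => .basic V hV.1, fun _ => symmDiff X O, fun _ => hnwd,
    (Set.iUnion_const _).symm⟩

end StrongRamsey

/-- In a strong topological Ramsey space with its Ellentuck topology, for any
`𝒳 ⊆ ℛ`: `𝒳` is Ramsey iff `𝒳` has the abstract Baire property iff `𝒳` has the Baire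
property. -/
theorem ramsey_iff_abp_iff_bp (S : CombStruct R α) (hS : S.IsStrongTRS)
    (X : Set R) :
    (S.RamseySet X ↔ S.ABP X) ∧ (S.ABP X ↔ S.BP X) := by
  exact ⟨⟨RamseySet.abp, fun h => hS.ramseySet_of_bp h.bp⟩,
    ⟨ABP.bp, fun h => (hS.ramseySet_of_bp h).abp⟩⟩

end CombStruct
end AbstractTRS
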